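/- For all m ≥ 1 and all n ≥ 4 + m, the highest power of x that occurs in the polynomial Q_{n,132}^{(2,1,m,0)}(x) is x^{n-3-m}, and its coefficient equals 3·C_m; that is, the coefficient of x^{n-3-m} in Q_{n,132}^{(2,1,m,0)}(x) is 3·C_m and the coefficient of x^r is 0 for every r > n-3-m. -/

import Mathlib

open Finset Polynomial

/-- `σ i` matches the quadrant marked mesh pattern `MMP(a,b,c,d)` in `σ`:
there are at least `a` indices `j > i` with `σ j > σ i`, at least `b` indices
`j < i` with `σ j > σ i`, at least `c` indices `j < i` with `σ j < σ i`, and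
at least `d` indices `j > i` with `σ j < σ i`. -/
def MatchesMMP {n : ℕ} (a b c d : ℕ) (σ : Equiv.Perm (Fin n)) (i : Fin n) : Prop :=
  a ≤ (Finset.univ.filter (fun j => i < j ∧ σ i < σ j)).card ∧
  b ≤ (Finset.univ.filter (fun j => j < i ∧ σ i < σ j)).card ∧
  c ≤ (Finset.univ.filter (fun j => j < i ∧ σ j < σ i)).card ∧
  d ≤ (Finset.univ.filter (fun j => i < j ∧ σ j < σ i)).card

instance {n : ℕ} (a b c d : ℕ) (σ : Equiv.Perm (Fin n)) :
    DecidablePred (MatchesMMP a b c d σ) := fun i => by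
  unfold MatchesMMP; infer_instance

/-- `mmp a b c d σ` is the number of indices `i` such that `σ i` matches
`MMP(a,b,c,d)` in `σ`. -/
def mmp {n : ℕ} (a b c d : ℕ) (σ : Equiv.Perm (Fin n)) : ℕ :=
  (Finset.univ.filter (MatchesMMP a b c d σ)).card

/-- `σ` avoids the classical pattern 132. -/
def Avoids132 {n : ℕ} (σ : Equiv.Perm (Fin n)) : Prop :=
  ¬ ∃ i j k : Fin n, i < j ∧ j < k ∧ σ i < σ k ∧ σ k < σ j

instance {n : ℕ} : DecidablePred (Avoids132 (n := n)) := fun σ => by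
  unfold Avoids132; infer_instance

/-- The set `S_n(132)` of 132-avoiding permutations of `{1,…,n}`. -/
def Av132 (n : ℕ) : Finset (Equiv.Perm (Fin n)) :=
  Finset.univ.filter Avoids132

/-- `Q n a b c d = Σ_{σ ∈ S_n(132)} x^{mmp^{(a,b,c,d)}(σ)}`, a polynomial in `ℤ[x]`. -/
noncomputable def Q (n a b c d : ℕ) : Polynomial ℤ :=
  ∑ σ ∈ Av132 n, Polynomial.X ^ (mmp a b c d σ)

/-- The underlying function `ℕ → ℕ` of a permutation of `Fin n`, extended by zero. -/
def toF {n : ℕ} (σ : Equiv.Perm (Fin n)) : ℕ → ℕ :=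
  fun i => if h : i < n then (σ ⟨i, h⟩ : ℕ) else 0

/-- Functions that encode 132-avoiding permutations. -/
structure IsW (n : ℕ) (f : ℕ → ℕ) : Prop where
  lt : ∀ i, i < n → f i < n
  inj : ∀ i j, i < n → j < n → f i = f j → i = j
  zero : ∀ i, n ≤ i → f i = 0
  av : ∀ i j k, i < j → j < k → k < n → f i < f k → f k < f j → False

theorem toF_fin {n : ℕ} (σ : Equiv.Perm (Fin n)) (i : Fin n) : toF σ i = σ i := by
  simp [toF]

theorem toF_injective (n : ℕ) : Function.Injective (toF (n := n)) := by
  intro σ τ h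
  ext i
  rw [← toF_fin, ← toF_fin, h]

theorem toF_isW {n : ℕ} (σ : Equiv.Perm (Fin n)) (h : Avoids132 σ) : IsW n (toF σ) := by
  refine ⟨?_, ?_, ?_, ?_⟩
  · intro i hi
    simp [toF, hi]
  · intro i j hi hj hij
    simp only [toF, hi, hj, dif_pos] at hij
    have := σ.injective (Fin.ext hij)
    simpa using this
  · intro i hi
    simp [toF, Nat.not_lt.2 hi]
  · intro i j k hij hjk hk h1 h2
    have hj : j < n := by omega
    have hi : i < n := by omega
    simp only [toF, hi, hj, hk, dif_pos] at h1 h2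
    exact h ⟨⟨i, hi⟩, ⟨j, hj⟩, ⟨k, hk⟩, hij, hjk, h1, h2⟩

theorem exists_perm {n : ℕ} {f : ℕ → ℕ} (h : IsW n f) :
    ∃ σ : Equiv.Perm (Fin n), Avoids132 σ ∧ toF σ = f := by
  let g : Fin n → Fin n := fun i => ⟨f i, h.lt i i.2⟩
  have hg : Function.Injective g := by
    intro i j hij
    apply Fin.ext
    apply h.inj _ _ i.2 j.2
    simpa [g] using hij
  refine ⟨Equiv.ofBijective g (Finite.injective_iff_bijective.1 hg), ?_, ?_⟩
  · rintro ⟨i, j, k, hij, hjk, h1, h2⟩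
    exact h.av i j k hij hjk k.2 h1 h2
  · funext i
    by_cases hi : i < n
    · simp [toF, hi, g]
    · simp [toF, hi, h.zero i (by omega)]

/-- The finset of encodings of 132-avoiding permutations. -/
noncomputable def TT (n : ℕ) : Finset (ℕ → ℕ) := by
  classical exact (Av132 n).image toF

theorem mem_TT {n : ℕ} {f : ℕ → ℕ} : f ∈ TT n ↔ IsW n f := by
  classical
  unfold TT
  simp only [Finset.mem_image, Av132, Finset.mem_filter, Finset.mem_univ, true_and]
  constructor
  · rintro ⟨σ, h, rfl⟩
    exact toF_isW σ h
  · exact exists_perm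

theorem count {n : ℕ} {f : ℕ → ℕ} (h : IsW n f) (S : Finset ℕ) (c d : ℕ)
    (hS : ∀ i ∈ S, i < n ∧ c ≤ f i ∧ f i < d) : S.card ≤ d - c := by
  rw [← Nat.card_Ico]
  apply Finset.card_le_card_of_injOn f
  · intro i hi
    have := hS i hi
    simp; omega
  · intro i hi j hj hij
    exact h.inj i j (hS i hi).1 (hS j hj).1 hij

/-- Gluing two encodings around a maximum placed at position `k`. -/
def glue (n k : ℕ) (p : (ℕ → ℕ) × (ℕ → ℕ)) : ℕ → ℕ :=
  fun i => if i < k then p.1 i + (n - k) else if i = k then n else p.2 (i - k - 1)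

theorem glue_isW {n k : ℕ} (hk : k ≤ n) {g h : ℕ → ℕ} (hg : IsW k g) (hh : IsW (n - k) h) :
    IsW (n + 1) (glue n k (g, h)) := by
  have key : ∀ i, i < n + 1 → (i < k ∧ glue n k (g, h) i = g i + (n - k) ∧ g i < k) ∨
      (i = k ∧ glue n k (g, h) i = n) ∨
      (k < i ∧ glue n k (g, h) i = h (i - k - 1) ∧ h (i - k - 1) < n - k) := by
    intro i hi
    rcases lt_trichotomy i k with h1 | h1 | h1
    · left; simp [glue, h1, hg.lt i h1]
    · right; left; simp [glue, h1]
    · right; right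
      refine ⟨h1, ?_, hh.lt _ (by omega)⟩
      simp [glue, Nat.not_lt.2 h1.le, h1.ne']
  refine ⟨?_, ?_, ?_, ?_⟩
  · intro i hi
    rcases key i hi with h1 | h1 | h1 <;> omega
  · intro i j hi hj hij
    have e1 := hg.inj i j
    have e2 := hh.inj (i - k - 1) (j - k - 1)
    rcases key i hi with h1 | h1 | h1 <;> rcases key j hj with h2 | h2 | h2 <;>
      omega
  · intro i hi
    have : h (i - k - 1) = 0 := hh.zero _ (by omega)
    have a1 : ¬ i < k := by omega
    have a2 : ¬ i = k := by omega
    simp [glue, this, a1, a2]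
  · intro i j l hij hjl hl h1 h2
    have e1 := hg.av i j l hij hjl
    have e2 := hh.av (i - k - 1) (j - k - 1) (l - k - 1)
    rcases key i (by omega) with a | a | a <;> rcases key j (by omega) with b | b | b <;>
      rcases key l hl with c | c | c <;> try omega
    · exact e1 c.1 (by omega) (by omega)
    · exact e2 (by omega) (by omega) (by omega) (by omega) (by omega)

theorem exists_glue {n : ℕ} {f : ℕ → ℕ} (hf : IsW (n + 1) f) :
    ∃ k, k ≤ n ∧ ∃ g h, IsW k g ∧ IsW (n - k) h ∧ glue n k (g, h) = f := by
  have hmax : ∃ k, k ≤ n ∧ f k = n := by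
    by_contra hcon
    push Not at hcon
    have := count hf (Finset.range (n + 1)) 0 n (by
      intro i hi
      have hi' := Finset.mem_range.1 hi
      have := hcon i (by omega)
      have := hf.lt i hi'
      omega)
    simp at this
  obtain ⟨k, hk, hfk⟩ := hmax
  have hlt : ∀ i, i < n + 1 → i ≠ k → f i < n := by
    intro i hi hik
    have h1 := hf.lt i hi
    have h2 := hf.inj i k hi (by omega)
    by_contra h3
    exact hik (h2 (by omega))
  have hcross : ∀ i j, i < k → k < j → j < n + 1 → f j < f i := by
    intro i j hi hj hjn
    have h1 := hf.av i k j hi hj hjn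
    have h2 := hlt j hjn (by omega)
    have h3 := hf.inj i j (by omega) hjn
    by_contra h4
    rcases Nat.lt_or_eq_of_le (Nat.not_lt.1 h4) with h5 | h5
    · exact h1 h5 (by omega)
    · have := h3 h5; omega
  have hlow : ∀ j, k < j → j < n + 1 → f j < n - k := by
    intro j hj hjn
    have := count hf (Finset.range (k + 1)) (f j + 1) (n + 1) (by
      intro i hi
      have hi' := Finset.mem_range.1 hi
      refine ⟨by omega, ?_, hf.lt i (by omega)⟩
      rcases Nat.lt_or_eq_of_le (Nat.le_of_lt_succ hi') with h | h
      · exact hcross i j h hj hjn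
      · rw [h, hfk]; exact hlt j hjn (by omega))
    have h2 := hlt j hjn (by omega)
    simp at this
    omega
  have hhigh : ∀ i, i < k → n - k ≤ f i := by
    intro i hi
    have := count hf (Finset.Ico (k + 1) (n + 1)) 0 (f i) (by
      intro j hj
      have hj' := Finset.mem_Ico.1 hj
      exact ⟨by omega, by omega, hcross i j hi (by omega) (by omega)⟩)
    simp at this
    omega
  refine ⟨k, hk, fun i => if i < k then f i - (n - k) else 0, fun j => f (j + k + 1), ?_, ?_, ?_⟩
  · refine ⟨?_, ?_, ?_, ?_⟩
    · intro i hi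
      have := hlt i (by omega) (by omega)
      have := hhigh i hi
      simp [hi]; omega
    · intro i j hi hj hij
      have := hhigh i hi
      have := hhigh j hj
      simp [hi, hj] at hij
      exact hf.inj i j (by omega) (by omega) (by omega)
    · intro i hi
      simp [Nat.not_lt.2 hi]
    · intro i j l hij hjl hl h1 h2
      have hi : i < k := by omega
      have hj : j < k := by omega
      simp only [hi, hj, hl, if_true] at h1 h2
      exact hf.av i j l hij hjl (by omega) (by omega) (by omega)
  · refine ⟨?_, ?_, ?_, ?_⟩
    · intro i hi
      exact hlow _ (by omega) (by omega)
    · intro i j hi hj hij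
      have := hf.inj _ _ (by omega) (by omega) hij
      omega
    · intro i hi
      exact hf.zero _ (by omega)
    · intro i j l hij hjl hl h1 h2
      exact hf.av _ _ _ (by omega) (by omega) (by omega) h1 h2
  · funext i
    rcases lt_trichotomy i k with h1 | h1 | h1
    · have := hhigh i h1
      simp [glue, h1]; omega
    · simp [glue, h1, hfk]
    · simp only [glue, Nat.not_lt.2 h1.le, h1.ne', if_false]
      congr 1; omega

theorem glue_injOn {n k : ℕ} :
    Set.InjOn (glue n k) (↑(TT k ×ˢ TT (n - k)) : Set ((ℕ → ℕ) × (ℕ → ℕ))) := by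
  rintro ⟨g, h⟩ h1 ⟨g', h'⟩ h2 heq
  simp only [Finset.coe_product, Set.mem_prod, Finset.mem_coe, mem_TT] at h1 h2
  have e := fun i => congrFun heq i
  ext i
  · show g i = g' i
    by_cases hi : i < k
    · have := e i
      simp [glue, hi] at this
      exact this
    · rw [h1.1.zero i (by omega), h2.1.zero i (by omega)]
  · show h i = h' i
    have := e (i + k + 1)
    have a1 : ¬ (i + k + 1 < k) := by omega
    have a2 : ¬ (i + k + 1 = k) := by omega
    have a3 : i + k + 1 - k - 1 = i := by omega
    simpa only [glue, a1, a2, a3, if_false] using this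

theorem card_TT_succ (n : ℕ) :
    (TT (n + 1)).card = ∑ k ∈ Finset.range (n + 1), (TT k).card * (TT (n - k)).card := by
  classical
  have hU : TT (n + 1) = (Finset.range (n + 1)).biUnion
      (fun k => (TT k ×ˢ TT (n - k)).image (glue n k)) := by
    ext f
    simp only [Finset.mem_biUnion, Finset.mem_range, Finset.mem_image, Finset.mem_product, mem_TT]
    constructor
    · intro hf
      obtain ⟨k, hk, g, h, hg, hh, e⟩ := exists_glue hf
      exact ⟨k, by omega, (g, h), ⟨hg, hh⟩, e⟩
    · rintro ⟨k, hk, ⟨g, h⟩, ⟨hg, hh⟩, rfl⟩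
      exact glue_isW (by omega) hg hh
  rw [hU, Finset.card_biUnion]
  · apply Finset.sum_congr rfl
    intro k _
    rw [Finset.card_image_of_injOn glue_injOn, Finset.card_product]
  · intro k hk l hl hkl
    show Disjoint _ _
    rw [Finset.disjoint_left]
    intro f hf1 hf2
    simp only [Finset.mem_image, Finset.mem_product, mem_TT, Finset.coe_range, Set.mem_Iio] at hf1 hf2 hk hl
    obtain ⟨⟨g, h⟩, ⟨hg, hh⟩, rfl⟩ := hf1
    obtain ⟨⟨g', h'⟩, ⟨hg', hh'⟩, e⟩ := hf2
    apply hkl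
    have w := glue_isW (by omega : k ≤ n) hg hh
    apply w.inj k l (by omega) (by omega)
    rw [← e]
    have e2 := congrFun e k
    rw [e2]
    simp [glue]

theorem card_TT (n : ℕ) : (TT n).card = catalan n := by
  induction n using Nat.strong_induction_on with
  | _ n ih =>
    cases n with
    | zero =>
      rw [catalan_zero, Finset.card_eq_one]
      refine ⟨fun _ => 0, ?_⟩
      ext f
      rw [mem_TT, Finset.mem_singleton]
      constructor
      · intro h
        funext i
        exact h.zero i (by omega)
      · rintro rfl
        exact ⟨by simp, by simp, by simp, by simp⟩
    | succ n =>
      rw [card_TT_succ, catalan_succ, Finset.sum_range]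
      apply Finset.sum_congr rfl
      intro k _
      rw [ih k (by omega), ih (n - k) (by omega)]

/-- The encodings of the extremal permutations. -/
def ext3 (n m : ℕ) (p : ℕ × (ℕ → ℕ)) : ℕ → ℕ :=
  fun i => if i = 0 then n - 1 - p.1 else if i ≤ m then p.2 (i - 1)
    else if n ≤ i then 0 else if n ≤ i + p.1 then i else i - 1

theorem ext3_key {n m c : ℕ} {g : ℕ → ℕ} (hn : 4 + m ≤ n) (hc : c < 3) (hg : IsW m g)
    (i : ℕ) (hi : i < n) :
    (i = 0 ∧ ext3 n m (c, g) i = n - 1 - c) ∨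
    (1 ≤ i ∧ i ≤ m ∧ ext3 n m (c, g) i = g (i - 1) ∧ g (i - 1) < m) ∨
    (m < i ∧ i < n - c ∧ ext3 n m (c, g) i = i - 1) ∨
    (m < i ∧ n - c ≤ i ∧ ext3 n m (c, g) i = i) := by
  by_cases h0 : i = 0
  · left; simp [ext3, h0]
  · right
    by_cases h1 : i ≤ m
    · left
      refine ⟨by omega, h1, ?_, hg.lt _ (by omega)⟩
      simp [ext3, h0, h1]
    · right
      by_cases h2 : n ≤ i + c
      · right
        refine ⟨by omega, by omega, ?_⟩
        simp [ext3, h0, h1, h2, Nat.not_le.2 hi]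
      · left
        refine ⟨by omega, by omega, ?_⟩
        simp [ext3, h0, h1, h2, Nat.not_le.2 hi]

theorem ext3_isW {n m c : ℕ} {g : ℕ → ℕ} (hn : 4 + m ≤ n) (hc : c < 3) (hg : IsW m g) :
    IsW n (ext3 n m (c, g)) := by
  have key := ext3_key hn hc hg
  refine ⟨?_, ?_, ?_, ?_⟩
  · intro i hi
    rcases key i hi with h | h | h | h <;> omega
  · intro i j hi hj hij
    have e := hg.inj (i - 1) (j - 1)
    rcases key i hi with h | h | h | h <;> rcases key j hj with h' | h' | h' | h' <;> omega
  · intro i hi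
    have h0 : i ≠ 0 := by omega
    have h1 : ¬ i ≤ m := by omega
    simp [ext3, h0, h1, hi]
  · intro i j k hij hjk hk h1 h2
    have e := hg.av (i - 1) (j - 1) (k - 1)
    rcases key i (by omega) with h | h | h | h <;>
      rcases key j (by omega) with h' | h' | h' | h' <;>
      rcases key k hk with h'' | h'' | h'' | h'' <;> try omega
    exact e (by omega) (by omega) (by omega) (by omega) (by omega)

theorem ext3_injOn {n m : ℕ} (hn : 4 + m ≤ n) :
    Set.InjOn (ext3 n m) (↑(Finset.range 3 ×ˢ TT m) : Set (ℕ × (ℕ → ℕ))) := by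
  rintro ⟨c, g⟩ h1 ⟨c', g'⟩ h2 heq
  simp only [Finset.coe_product, Set.mem_prod, Finset.mem_coe, mem_TT, Finset.mem_range] at h1 h2
  have e := fun i => congrFun heq i
  apply Prod.ext
  · have := e 0
    simp [ext3] at this
    show c = c'
    omega
  · funext i
    show g i = g' i
    by_cases hi : i < m
    · have := e (i + 1)
      have a : i + 1 ≤ m := by omega
      simpa [ext3, a] using this
    · rw [h1.2.zero i (by omega), h2.2.zero i (by omega)]

theorem exists_ext3 {n m : ℕ} {f : ℕ → ℕ} (hn : 4 + m ≤ n) (hf : IsW n f)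
    (ha : f (n - 3) < f 0)
    (hb : ∀ i j, m + 1 ≤ i → i < j → j < n → f i < f j)
    (hc : ∀ j, 1 ≤ j → j ≤ m → f j < f (m + 1)) :
    ∃ c, c < 3 ∧ ∃ g, IsW m g ∧ ext3 n m (c, g) = f := by
  have hble : ∀ i j, m + 1 ≤ i → i ≤ j → j < n → f i ≤ f j := by
    intro i j h1 h2 h3
    rcases Nat.lt_or_eq_of_le h2 with h | h
    · exact (hb i j h1 h h3).le
    · rw [h]
  have hsm : ∀ i j, m + 1 ≤ i → 1 ≤ j → j < i → i < n → f j < f i := by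
    intro i j h1 h2 h3 h4
    by_cases h : j ≤ m
    · exact lt_of_lt_of_le (hc j h2 h) (hble _ _ le_rfl h1 h4)
    · exact hb j i (by omega) h3 h4
  have hle3 : ∀ j, 1 ≤ j → j ≤ n - 3 → f j < f 0 := by
    intro j h1 h2
    rcases Nat.lt_or_eq_of_le h2 with h | h
    · exact (hsm (n - 3) j (by omega) h1 h (by omega)).trans ha
    · rw [h]; exact ha
  have hlow : ∀ j, 1 ≤ j → j ≤ m → f j < m := by
    intro j h1 h2
    have := count hf (insert 0 (Finset.Ico (m + 1) n)) (f j + 1) n (by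
      intro i hi
      rw [Finset.mem_insert, Finset.mem_Ico] at hi
      rcases hi with rfl | hi
      · exact ⟨by omega, hle3 j h1 (by omega), hf.lt 0 (by omega)⟩
      · exact ⟨hi.2, hsm i j hi.1 h1 (by omega) hi.2, hf.lt i hi.2⟩)
    rw [Finset.card_insert_of_notMem (by simp), Nat.card_Ico] at this
    omega
  have hlb : ∀ i, m + 1 ≤ i → i < n → i - 1 ≤ f i := by
    intro i h1 h2
    have := count hf (Finset.Ico 1 i) 0 (f i) (by
      intro j hj
      have hj' := Finset.mem_Ico.1 hj
      exact ⟨by omega, by omega, hsm i j h1 hj'.1 hj'.2 h2⟩)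
    rw [Nat.card_Ico] at this
    omega
  have hub : ∀ i, m + 1 ≤ i → i ≤ n - 3 → f i ≤ i - 1 := by
    intro i h1 h2
    have := count hf (insert 0 (Finset.Ico (i + 1) n)) (f i + 1) n (by
      intro j hj
      rw [Finset.mem_insert, Finset.mem_Ico] at hj
      rcases hj with rfl | hj
      · exact ⟨by omega, hle3 i (by omega) (by omega), hf.lt 0 (by omega)⟩
      · exact ⟨hj.2, hb i j h1 (by omega) hj.2, hf.lt j hj.2⟩)
    rw [Finset.card_insert_of_notMem (by simp), Nat.card_Ico] at this
    have := hf.lt i (by omega)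
    omega
  have h0 : n - 3 ≤ f 0 := by
    have := hub (n - 3) (by omega) le_rfl
    have := hlb (n - 3) (by omega) (by omega)
    omega
  have hl0 := hf.lt 0 (by omega)
  have hl1 := hf.lt (n - 1) (by omega)
  have hl2 := hb (n - 2) (n - 1) (by omega) (by omega) (by omega)
  have hl3 := hlb (n - 2) (by omega) (by omega)
  have hne1 : f 0 ≠ f (n - 1) := fun h => by
    have := hf.inj 0 (n - 1) (by omega) (by omega) h
    omega
  have hne2 : f 0 ≠ f (n - 2) := fun h => by
    have := hf.inj 0 (n - 2) (by omega) (by omega) h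
    omega
  have hg : IsW m (fun i => if i < m then f (i + 1) else 0) := by
    refine ⟨?_, ?_, ?_, ?_⟩
    · intro i hi
      simp only [hi, if_true]
      exact hlow _ (by omega) (by omega)
    · intro i j hi hj hij
      simp only [hi, hj, if_true] at hij
      have := hf.inj _ _ (by omega) (by omega) hij
      omega
    · intro i hi
      simp [Nat.not_lt.2 hi]
    · intro i j k hij hjk hk h1 h2
      have hi : i < m := by omega
      have hj : j < m := by omega
      simp only [hi, hj, hk, if_true] at h1 h2
      exact hf.av _ _ _ (by omega) (by omega) (by omega) h1 h2
  have hcc : n - 1 - f 0 < 3 := by omega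
  refine ⟨n - 1 - f 0, hcc, _, hg, ?_⟩
  funext i
  by_cases hi : i < n
  · rcases ext3_key hn hcc hg i hi with h | h | h | h
    · rw [h.2, h.1]; omega
    · rw [h.2.2.1]
      have : i - 1 < m := by omega
      simp only [this, if_true]
      congr 1; omega
    · rw [h.2.2]
      by_cases h3 : i ≤ n - 3
      · have := hub i (by omega) h3
        have := hlb i (by omega) hi
        omega
      · have : i = n - 2 ∨ i = n - 1 := by omega
        rcases this with rfl | rfl <;> omega
    · rw [h.2.2]
      have : i = n - 2 ∨ i = n - 1 := by omega
      rcases this with rfl | rfl <;> omega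
  · rw [(ext3_isW hn hcc hg).zero i (by omega), hf.zero i (by omega)]

/-- The window of positions that can match. -/
def win (n m : ℕ) : Finset (Fin n) := Finset.univ.filter (fun i => m + 1 ≤ i.1 ∧ i.1 + 3 ≤ n)

theorem card_win (n m : ℕ) (hn : 4 + m ≤ n) : (win n m).card = n - 3 - m := by
  have : (win n m).map Fin.valEmbedding = Finset.Ico (m + 1) (n - 2) := by
    ext i
    simp only [win, Finset.mem_map, Finset.mem_filter, Finset.mem_univ, true_and,
      Fin.valEmbedding_apply, Finset.mem_Ico]
    constructor
    · rintro ⟨a, h, rfl⟩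
      omega
    · intro h
      exact ⟨⟨i, by omega⟩, by simp; omega, rfl⟩
  rw [← Finset.card_map Fin.valEmbedding, this, Nat.card_Ico]
  omega

theorem matches_win {n m : ℕ} (σ : Equiv.Perm (Fin n)) (i : Fin n)
    (h : MatchesMMP 2 1 m 0 σ i) : i ∈ win n m := by
  obtain ⟨h1, h2, h3, -⟩ := h
  simp only [win, Finset.mem_filter, Finset.mem_univ, true_and]
  constructor
  · have hd : Disjoint (Finset.univ.filter (fun j => j < i ∧ σ i < σ j))
        (Finset.univ.filter (fun j => j < i ∧ σ j < σ i)) := by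
      rw [Finset.disjoint_left]
      intro j hj hj'
      simp only [Finset.mem_filter, Finset.mem_univ, true_and] at hj hj'
      exact lt_asymm hj.2 hj'.2
    have := Finset.card_union_of_disjoint hd
    have hs : (Finset.univ.filter (fun j => j < i ∧ σ i < σ j)) ∪
        (Finset.univ.filter (fun j => j < i ∧ σ j < σ i)) ⊆ Finset.Iio i := by
      intro j hj
      simp only [Finset.mem_union, Finset.mem_filter, Finset.mem_univ, true_and] at hj
      rw [Finset.mem_Iio]
      tauto
    have := Finset.card_le_card hs
    rw [Fin.card_Iio] at this
    omega
  · have hs : (Finset.univ.filter (fun j => i < j ∧ σ i < σ j)) ⊆ Finset.Ioi i := by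
      intro j hj
      simp only [Finset.mem_filter, Finset.mem_univ, true_and] at hj
      rw [Finset.mem_Ioi]
      exact hj.1
    have := Finset.card_le_card hs
    rw [Fin.card_Ioi] at this
    omega

theorem mmp_le {n m : ℕ} (hn : 4 + m ≤ n) (σ : Equiv.Perm (Fin n)) :
    mmp 2 1 m 0 σ ≤ n - 3 - m := by
  rw [← card_win n m hn]
  apply Finset.card_le_card
  intro i hi
  exact matches_win σ i (by simpa using hi)

theorem mmp_eq_iff {n m : ℕ} (hn : 4 + m ≤ n) (σ : Equiv.Perm (Fin n)) :
    mmp 2 1 m 0 σ = n - 3 - m ↔ ∀ i ∈ win n m, MatchesMMP 2 1 m 0 σ i := by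
  have hsub : Finset.univ.filter (MatchesMMP 2 1 m 0 σ) ⊆ win n m := by
    intro i hi
    exact matches_win σ i (by simpa using hi)
  constructor
  · intro h i hi
    have := Finset.eq_of_subset_of_card_le hsub (by rw [card_win n m hn]; exact h.ge)
    rw [← this] at hi
    simpa using hi
  · intro h
    rw [← card_win n m hn]
    unfold mmp
    congr 1
    apply Finset.Subset.antisymm hsub
    intro i hi
    simpa using h i hi

theorem extremal_forward {n m : ℕ} (hm : 1 ≤ m) (hn : 4 + m ≤ n) (σ : Equiv.Perm (Fin n))
    (hav : Avoids132 σ) (hall : ∀ i ∈ win n m, MatchesMMP 2 1 m 0 σ i) :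
    ∃ c, c < 3 ∧ ∃ g, IsW m g ∧ ext3 n m (c, g) = toF σ := by
  have hf := toF_isW σ hav
  set f := toF σ with hfdef
  have hfin : ∀ i : Fin n, (σ i : ℕ) = f i := fun i => (toF_fin σ i).symm
  have hlt : ∀ i j : Fin n, σ i < σ j ↔ f i < f j := by
    intro i j
    rw [← hfin, ← hfin]; rfl
  have hmatch : ∀ i : ℕ, (hi : m + 1 ≤ i) → (hi' : i + 3 ≤ n) →
      MatchesMMP 2 1 m 0 σ ⟨i, by omega⟩ := by
    intro i hi hi'
    apply hall
    simp only [win, Finset.mem_filter, Finset.mem_univ, true_and]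
    exact ⟨hi, hi'⟩
  have hNW : ∀ i, m + 1 ≤ i → i + 3 ≤ n → ∃ j, j < i ∧ f i < f j := by
    intro i hi hi'
    obtain ⟨-, h, -, -⟩ := hmatch i hi hi'
    obtain ⟨j, hj⟩ := Finset.card_pos.1 h
    simp only [Finset.mem_filter, Finset.mem_univ, true_and] at hj
    exact ⟨j, hj.1, (hlt _ _).1 hj.2⟩
  have hSW : ∀ i, m + 1 ≤ i → i + 3 ≤ n → ∃ j, j < i ∧ f j < f i := by
    intro i hi hi'
    obtain ⟨-, -, h, -⟩ := hmatch i hi hi'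
    obtain ⟨j, hj⟩ := Finset.card_pos.1 (lt_of_lt_of_le hm h)
    simp only [Finset.mem_filter, Finset.mem_univ, true_and] at hj
    exact ⟨j, hj.1, (hlt _ _).1 hj.2⟩
  -- the last two entries exceed the entry at `n - 3`
  have hlast : ∀ j, n - 3 < j → j < n → f (n - 3) < f j := by
    intro j hj hjn
    obtain ⟨h, -, -, -⟩ := hmatch (n - 3) (by omega) (by omega)
    have hsub : (Finset.univ.filter (fun k : Fin n => (⟨n - 3, by omega⟩ : Fin n) < k ∧
        σ ⟨n - 3, by omega⟩ < σ k)) ⊆ Finset.Ioi ⟨n - 3, by omega⟩ := by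
      intro k hk
      simp only [Finset.mem_filter, Finset.mem_univ, true_and] at hk
      exact Finset.mem_Ioi.2 hk.1
    have heq := Finset.eq_of_subset_of_card_le hsub (by
      rw [Fin.card_Ioi]
      refine le_trans ?_ h
      show n - 1 - (n - 3) ≤ 2
      omega)
    have hmem : (⟨j, hjn⟩ : Fin n) ∈ Finset.Ioi (⟨n - 3, by omega⟩ : Fin n) :=
      Finset.mem_Ioi.2 hj
    rw [← heq] at hmem
    simp only [Finset.mem_filter, Finset.mem_univ, true_and] at hmem
    exact (hlt _ _).1 hmem.2
  have hne : ∀ i j, i < n → j < n → i ≠ j → f i ≠ f j := fun i j hi hj hij h =>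
    hij (hf.inj i j hi hj h)
  have hstep : ∀ i, m + 1 ≤ i → i + 1 < n → f i < f (i + 1) := by
    intro i hi hin
    by_contra hcon
    have h1 := hne i (i + 1) (by omega) hin (by omega)
    by_cases h4 : i + 4 ≤ n
    · obtain ⟨j, hj, hj'⟩ := hSW (i + 1) (by omega) (by omega)
      have : j ≠ i := by rintro rfl; omega
      exact hf.av j i (i + 1) (by omega) (by omega) hin hj' (by omega)
    · by_cases h3 : i = n - 3
      · subst h3
        exact hcon (hlast _ (by omega) hin)
      · exact hf.av (n - 3) i (i + 1) (by omega) (by omega) hin (hlast _ (by omega) hin)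
          (by omega)
  have hb : ∀ i j, m + 1 ≤ i → i < j → j < n → f i < f j := by
    intro i j hi hij
    induction j, hij using Nat.le_induction with
    | base => intro h; exact hstep i hi h
    | succ j hj ih =>
      intro h
      exact (ih (by omega)).trans (hstep j (by omega) h)
  -- position `m + 1`
  have hc : ∀ j, 1 ≤ j → j ≤ m → f j < f (m + 1) := by
    intro j hj1 hjm
    obtain ⟨-, -, h, -⟩ := hmatch (m + 1) le_rfl (by omega)
    by_contra hcon
    have hj2 := hne j (m + 1) (by omega) (by omega) (by omega)
    have h0 : ¬ f 0 < f (m + 1) := fun h0 =>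
      hf.av 0 j (m + 1) (by omega) (by omega) (by omega) h0 (by omega)
    have hsub : (Finset.univ.filter (fun k : Fin n => k < (⟨m + 1, by omega⟩ : Fin n) ∧
        σ k < σ ⟨m + 1, by omega⟩)).map Fin.valEmbedding ⊆
        ((Finset.range (m + 1)).erase 0).erase j := by
      intro k hk
      simp only [Finset.mem_map, Finset.mem_filter, Finset.mem_univ, true_and,
        Fin.valEmbedding_apply] at hk
      obtain ⟨a, ⟨ha1, ha2⟩, rfl⟩ := hk
      have ha3 := (hlt _ _).1 ha2
      simp only [Finset.mem_erase, Finset.mem_range]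
      refine ⟨?_, ?_, ha1⟩
      · intro e; rw [e] at ha3; exact hcon ha3
      · intro e; rw [e] at ha3; exact h0 ha3
    have := Finset.card_le_card hsub
    rw [Finset.card_map, Finset.card_erase_of_mem (by simp; omega),
      Finset.card_erase_of_mem (by simp), Finset.card_range] at this
    omega
  have ha : f (n - 3) < f 0 := by
    obtain ⟨j, hj, hj'⟩ := hNW (n - 3) (by omega) (by omega)
    by_cases h0 : j = 0
    · rwa [h0] at hj'
    · exfalso
      by_cases h1 : j ≤ m
      · have h2 := hc j (by omega) h1
        by_cases h3 : m + 1 = n - 3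
        · rw [h3] at h2; omega
        · have := hb (m + 1) (n - 3) le_rfl (by omega) (by omega)
          omega
      · have := hb j (n - 3) (by omega) hj (by omega)
        omega
  exact exists_ext3 hn hf ha hb hc

theorem extremal_backward {n m c : ℕ} {g : ℕ → ℕ} (hn : 4 + m ≤ n) (σ : Equiv.Perm (Fin n))
    (hc : c < 3) (hg : IsW m g) (he : ext3 n m (c, g) = toF σ) :
    ∀ i ∈ win n m, MatchesMMP 2 1 m 0 σ i := by
  have key := ext3_key hn hc hg
  rw [he] at key
  have hlt : ∀ i j : Fin n, σ i < σ j ↔ toF σ i < toF σ j := by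
    intro i j
    rw [toF_fin, toF_fin]; rfl
  intro i hi
  simp only [win, Finset.mem_filter, Finset.mem_univ, true_and] at hi
  have ki := key i i.2
  refine ⟨?_, ?_, ?_, Nat.zero_le _⟩
  · have : ({⟨n - 2, by omega⟩, ⟨n - 1, by omega⟩} : Finset (Fin n)).card = 2 := by
      apply Finset.card_pair
      intro h
      have := congrArg Fin.val h
      simp at this
      omega
    rw [← this]
    apply Finset.card_le_card
    intro j hj
    simp only [Finset.mem_insert, Finset.mem_singleton] at hj
    simp only [Finset.mem_filter, Finset.mem_univ, true_and, hlt, Fin.lt_def]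
    have hj' : j.1 = n - 2 ∨ j.1 = n - 1 := by
      rcases hj with rfl | rfl <;> simp
    have kj := key j j.2
    omega
  · apply Finset.card_pos.2
    refine ⟨⟨0, by omega⟩, ?_⟩
    simp only [Finset.mem_filter, Finset.mem_univ, true_and, hlt, Fin.lt_def]
    have kj := key 0 (by omega)
    omega
  · have hsub : Finset.Ico 1 (m + 1) ⊆ (Finset.univ.filter
        (fun j : Fin n => j < i ∧ σ j < σ i)).map Fin.valEmbedding := by
      intro k hk
      rw [Finset.mem_Ico] at hk
      simp only [Finset.mem_map, Finset.mem_filter, Finset.mem_univ, true_and,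
        Fin.valEmbedding_apply]
      refine ⟨⟨k, by omega⟩, ?_, rfl⟩
      simp only [hlt, Fin.lt_def]
      have kj := key k (by omega)
      omega
    have := Finset.card_le_card hsub
    rw [Finset.card_map, Nat.card_Ico] at this
    omega

theorem card_extremal (m n : ℕ) (hm : 1 ≤ m) (hn : 4 + m ≤ n) :
    ((Av132 n).filter (fun σ => mmp 2 1 m 0 σ = n - 3 - m)).card = 3 * catalan m := by
  classical
  have h : ((Av132 n).filter (fun σ => mmp 2 1 m 0 σ = n - 3 - m)).image toF =
      (Finset.range 3 ×ˢ TT m).image (ext3 n m) := by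
    ext f
    simp only [Finset.mem_image, Finset.mem_filter, Av132, Finset.mem_univ, true_and,
      Finset.mem_product, Finset.mem_range, mem_TT, mmp_eq_iff hn]
    constructor
    · rintro ⟨σ, ⟨h1, h2⟩, rfl⟩
      obtain ⟨c, hc, g, hg, e⟩ := extremal_forward hm hn σ h1 h2
      exact ⟨(c, g), ⟨hc, hg⟩, e⟩
    · rintro ⟨⟨c, g⟩, ⟨hc, hg⟩, rfl⟩
      obtain ⟨σ, h1, h2⟩ := exists_perm (ext3_isW hn hc hg)
      exact ⟨σ, ⟨h1, extremal_backward hn σ hc hg h2.symm⟩, h2⟩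
  rw [← Finset.card_image_of_injective _ (toF_injective n), h,
    Finset.card_image_of_injOn (ext3_injOn hn), Finset.card_product, Finset.card_range, card_TT]

theorem coeff_Q (n a b c d r : ℕ) :
    (Q n a b c d).coeff r = (((Av132 n).filter (fun σ => mmp a b c d σ = r)).card : ℤ) := by
  unfold Q
  rw [Polynomial.finsetSum_coeff, Finset.card_filter]
  push_cast
  apply Finset.sum_congr rfl
  intro σ _
  rw [Polynomial.coeff_X_pow]
  simp [eq_comm]

/-- for `m ≥ 1` and `n ≥ 4 + m`, the highest power of `x` in
`Q_{n,132}^{(2,1,m,0)}(x)` is `x^{n-3-m}`, with coefficient `3·C_m`. -/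
theorem stmt5 (m n : ℕ) (hm : 1 ≤ m) (hn : 4 + m ≤ n) :
    (Q n 2 1 m 0).coeff (n - 3 - m) = (3 * catalan m : ℤ) ∧
    ∀ r : ℕ, n - 3 - m < r → (Q n 2 1 m 0).coeff r = 0 := by
  constructor
  · rw [coeff_Q, card_extremal m n hm hn]
    push_cast
    rfl
  · intro r hr
    rw [coeff_Q, Nat.cast_eq_zero, Finset.card_eq_zero, Finset.filter_eq_empty_iff]
    intro σ _ h
    have := mmp_le hn σ
    omega
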